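/- (Neutral stability condition, Eq. (13) of the paper.) With f(T, T') = Im(z⋆ + ((-i - z⋆)·exp((-1 + 10i)T) + K)·exp((-1 + 10i)T')) and z⋆ = I/101 + (10I/101)i, suppose K ≠ 0, cos(10T') ≠ 0, and ∂f/∂T'(T, T') ≠ 0. Then the return-map slope m = -(∂f/∂T(T, T'))/(∂f/∂T'(T, T')) equals -1 if and only if tan(10T') = 10; equivalently, m = -1 if and only if K·(tan(10T') - 10) = 0. -/

import Mathlib

/-- The value of `y` at time `T + T'` for the orbit of the resonate-and-fire
model that is reset to `z = -i` at time `0` and receives a pulse of strength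
`K` (added to the `x`-coordinate) at time `T`, with fixed point
`z⋆ = I/101 + (10I/101) i`. -/
noncomputable def rfFiringMapF (I K : ℝ) (T T' : ℝ) : ℝ :=
  (((I : ℂ) / 101 + (10 * (I : ℂ) / 101) * Complex.I) +
    ((-Complex.I - ((I : ℂ) / 101 + (10 * (I : ℂ) / 101) * Complex.I)) *
        Complex.exp ((-1 + 10 * Complex.I) * T) + (K : ℂ)) *
      Complex.exp ((-1 + 10 * Complex.I) * T')).im

lemma rf_aux_exp (t : ℝ) : HasDerivAt (fun s : ℝ => Complex.exp ((-1 + 10 * Complex.I) * s))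
    (Complex.exp ((-1 + 10 * Complex.I) * t) * (-1 + 10 * Complex.I)) t := by
  have h : HasDerivAt (fun z : ℂ => Complex.exp ((-1 + 10 * Complex.I) * z))
    (Complex.exp ((-1 + 10 * Complex.I) * t) * (-1 + 10 * Complex.I)) (t : ℂ) := by
    simpa using ((hasDerivAt_id (t : ℂ)).const_mul (-1 + 10 * Complex.I)).cexp
  exact h.comp_ofReal

lemma rf_aux_im {g : ℝ → ℂ} {g' : ℂ} {t : ℝ} (h : HasDerivAt g g' t) :
    HasDerivAt (fun s => (g s).im) g'.im t :=
  Complex.imCLM.hasFDerivAt.comp_hasDerivAt t h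

lemma rf_aux_key (I K T T' : ℝ) :
    deriv (fun s => rfFiringMapF I K T s) T' - deriv (fun s => rfFiringMapF I K s T') T
      = K * (Real.exp (-T') * (10 * Real.cos (10 * T') - Real.sin (10 * T'))) := by
  unfold rfFiringMapF
  rw [(rf_aux_im (((rf_aux_exp T').const_mul _).const_add _)).deriv,
    (rf_aux_im (((((rf_aux_exp T).const_mul _).add_const _).mul_const _).const_add _)).deriv,
    ← Complex.sub_im]
  have e : Complex.exp ((-1 + 10 * Complex.I) * T') =
      (Real.exp (-T') : ℂ) * ((Real.cos (10 * T') : ℂ) + (Real.sin (10 * T') : ℂ) * Complex.I) := by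
    push_cast
    rw [← Complex.exp_mul_I, ← Complex.exp_add]
    congr 1
    ring
  have e2 : ∀ c E a F k : ℂ, (c * E + k) * (F * a) - c * (E * a) * F = k * (F * a) := by
    intros; ring
  rw [e2, e]
  have e3 : ∀ k r c s : ℝ, ((k : ℂ) * ((r : ℂ) * ((c : ℂ) + (s : ℂ) * Complex.I)
      * (-1 + 10 * Complex.I))).im = k * (r * (10 * c - s)) := by
    intro k r c s
    simp
    left
    ring
  exact e3 _ _ _ _

/-- Neutral stability condition, Eq. (13): if `K ≠ 0`,
`cos 10T' ≠ 0`, and `∂f/∂T'(T, T') ≠ 0`, then the return-map slope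
`m = -(∂f/∂T)/(∂f/∂T')` equals `-1` iff `tan 10T' = 10`; equivalently,
`m = -1` iff `K (tan 10T' - 10) = 0`. -/
theorem rf_neutral_stability_condition (I K T T' : ℝ)
    (hK : K ≠ 0) (hcos : Real.cos (10 * T') ≠ 0)
    (hfT' : deriv (fun s => rfFiringMapF I K T s) T' ≠ 0) :
    (-(deriv (fun s => rfFiringMapF I K s T') T) /
        (deriv (fun s => rfFiringMapF I K T s) T') = -1 ↔ Real.tan (10 * T') = 10) ∧
    (-(deriv (fun s => rfFiringMapF I K s T') T) /
        (deriv (fun s => rfFiringMapF I K T s) T') = -1 ↔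
      K * (Real.tan (10 * T') - 10) = 0) := by
  have key := rf_aux_key I K T T'
  have he := (Real.exp_pos (-T')).ne'
  have h1 : -(deriv (fun s => rfFiringMapF I K s T') T) /
        (deriv (fun s => rfFiringMapF I K T s) T') = -1 ↔ Real.tan (10 * T') = 10 := by
    rw [div_eq_iff hfT', Real.tan_eq_sin_div_cos, div_eq_iff hcos]
    constructor
    · intro h
      have h0 : K * (Real.exp (-T') * (10 * Real.cos (10 * T') - Real.sin (10 * T'))) = 0 := by
        rw [← key]; linarith
      have := (mul_eq_zero.mp ((mul_eq_zero.mp h0).resolve_left hK)).resolve_left he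
      linarith
    · intro h
      rw [h] at key
      linarith
  refine ⟨h1, h1.trans ?_⟩
  rw [mul_eq_zero, sub_eq_zero]
  simp [hK]
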